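/- Let p : E ⥤ B be a Grothendieck fibration between categories (every morphism of B with specified lift of its codomain admits a cartesian lift), let b be an initial object of B, and let e be an object of E lying over b (p.obj e = b) which is initial in the fiber category of p over b (the subcategory of E of objects over b and morphisms over the identity of b). Then e is an initial object of E. -/

import Mathlib

open CategoryTheory CategoryTheory.Limits

/-- Let `p : E ⥤ B` be a Grothendieck fibration, `b` an initial object of `B`,
and `e` an object of `E` over `b` which is initial in the fiber of `p` over `b`.
Then `e` is initial in `E`. -/
theorem isInitial_of_isInitial_in_fiber {E B : Type*} [Category E] [Category B]
    (p : E ⥤ B) [p.IsFibered] (b : B) (hb : IsInitial b)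
    (e : E) (he : p.obj e = b)
    (hef : @IsInitial (Functor.Fiber p b) _ ⟨e, he⟩) :
    Nonempty (IsInitial e) := by
  have key : ∀ x : E, Nonempty (Unique (e ⟶ x)) := by
    intro x
    obtain ⟨y, φ, hφ⟩ := IsPreFibered.exists_isCartesian p (rfl : p.obj x = p.obj x)
      (hb.to (p.obj x))
    have hy : p.obj y = b := IsHomLift.domain_eq p (hb.to (p.obj x)) φ
    let Y : Functor.Fiber p b := ⟨y, hy⟩
    let t := hef.to Y
    refine ⟨⟨⟨t.1 ≫ φ⟩, fun g => ?_⟩⟩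
    have hg : p.IsHomLift (hb.to (p.obj x)) g :=
      IsHomLift.of_fac p _ g he rfl (hb.hom_ext _ _)
    obtain ⟨χ, ⟨hχ, hχg⟩, -⟩ :=
      Functor.IsCartesian.universal_property (p := p) (f := hb.to (p.obj x)) (φ := φ) g
    let s : Functor.Fiber.mk he ⟶ Y := ⟨χ, hχ⟩
    have hst : s = t := hef.hom_ext s t
    have h1 : χ = t.1 := congrArg Subtype.val hst
    change g = t.1 ≫ φ
    rw [← h1, hχg]
  have := fun x => (key x).some
  exact ⟨IsInitial.ofUnique e⟩
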